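/- arXiv:0711.4486 — 3 statements merged into one kernel-verified Lean document; each statement's English description precedes it below -/
import Mathlib

section
/- Let u ∈ ℝ^d be a unit vector and x ∈ ℝ^d. Define the closed cone C(x) := {z ∈ ℝ^d : ⟨z − x, u⟩ ≥ |z − x|·cos(π/12)} and the concentric open cone C⁺(x) := {z ∈ ℝ^d : z ≠ x and ⟨z − x, u⟩ > |z − x|·cos(π/6)}. If 𝒳 ⊂ ℝ^d is finite with x ∈ 𝒳, and y ∈ 𝒳 ∩ C⁺(x), then every point z in Ṽ(x;𝒳) ∩ C(x) satisfies |z − x| ≤ |y − x|; that is, the part of the Voronoi cell of x lying in the narrower cone is contained in the closed ball of radius |y − x| centred at x. -/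
open MeasureTheory Filter Topology
open scoped RealInnerProductSpace

noncomputable section

/-- Euclidean space `ℝ^d`. -/
abbrev EucSp (d : ℕ) := EuclideanSpace ℝ (Fin d)

/-- The closed Voronoi cell of `x` relative to the point set `S`:
all points at least as close to `x` as to any point of `S`. -/
def vorCell {d : ℕ} (x : EucSp d) (S : Set (EucSp d)) : Set (EucSp d) :=
  {y | ∀ z ∈ S, dist y x ≤ dist y z}

/-- If `y ∈ 𝒳` lies in the open cone `C⁺(x)` of angular radius `π/6` about direction `u`,
then every `z` in `Ṽ(x;𝒳)` lying in the closed cone `C(x)` of angular radius `π/12`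
satisfies `|z − x| ≤ |y − x|`. -/
theorem stmt5 {d : ℕ} (hd : 1 ≤ d) (u x : EucSp d) (hu : ‖u‖ = 1)
    (𝒳 : Set (EucSp d)) (h𝒳 : 𝒳.Finite) (hx : x ∈ 𝒳)
    (y : EucSp d) (hy𝒳 : y ∈ 𝒳) (hyx : y ≠ x)
    (hyC : ‖y - x‖ * Real.cos (Real.pi / 6) < ⟪y - x, u⟫)
    (z : EucSp d) (hz : z ∈ vorCell x 𝒳)
    (hzC : ‖z - x‖ * Real.cos (Real.pi / 12) ≤ ⟪z - x, u⟫) :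
    ‖z - x‖ ≤ ‖y - x‖ := by
  rcases eq_or_ne z x with rfl | hzx
  · simp
  have hb : 0 < ‖y - x‖ := norm_pos_iff.2 (sub_ne_zero.2 hyx)
  have ha : 0 < ‖z - x‖ := norm_pos_iff.2 (sub_ne_zero.2 hzx)
  have hv : dist z x ≤ dist z y := hz y hy𝒳
  rw [dist_eq_norm, dist_eq_norm, ← sub_sub_sub_cancel_right z y x] at hv
  generalize y - x = b at *
  generalize z - x = a at *
  have hpi := Real.pi_pos
  have h1 : InnerProductGeometry.angle a u ≤ Real.pi / 12 := by
    have hc : Real.cos (Real.pi / 12) ≤ Real.cos (InnerProductGeometry.angle a u) := by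
      rw [InnerProductGeometry.cos_angle, hu, mul_one, le_div_iff₀ ha]
      linarith
    by_contra! h
    exact absurd (Real.cos_lt_cos_of_nonneg_of_le_pi (by positivity)
      (InnerProductGeometry.angle_le_pi a u) h) (not_lt.2 hc)
  have h2 : InnerProductGeometry.angle u b ≤ Real.pi / 6 := by
    rw [InnerProductGeometry.angle_comm]
    have hc : Real.cos (Real.pi / 6) ≤ Real.cos (InnerProductGeometry.angle b u) := by
      rw [InnerProductGeometry.cos_angle, hu, mul_one, le_div_iff₀ hb]
      linarith
    by_contra! h
    exact absurd (Real.cos_lt_cos_of_nonneg_of_le_pi (by positivity)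
      (InnerProductGeometry.angle_le_pi b u) h) (not_lt.2 hc)
  have h3 : InnerProductGeometry.angle a b ≤ Real.pi / 3 := by
    have := InnerProductGeometry.angle_le_angle_add_angle a u b
    linarith
  have h4 : 1 / 2 ≤ Real.cos (InnerProductGeometry.angle a b) := by
    rw [← Real.cos_pi_div_three]
    exact Real.cos_le_cos_of_nonneg_of_le_pi (InnerProductGeometry.angle_nonneg a b)
      (by linarith) h3
  rw [InnerProductGeometry.cos_angle, le_div_iff₀ (by positivity)] at h4
  have h5 : ‖a‖ ^ 2 ≤ ‖a - b‖ ^ 2 := by gcongr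
  rw [norm_sub_sq_real] at h5
  have h6 : ‖a‖ * ‖b‖ ≤ ‖b‖ * ‖b‖ := by nlinarith
  exact le_of_mul_le_mul_right h6 hb
end
end

section
/- Let x ∈ ℝ^d and let u_1, …, u_I be unit vectors such that the closed cones C_i := {z ∈ ℝ^d : ⟨z − x, u_i⟩ ≥ |z − x|·cos(π/12)}, 1 ≤ i ≤ I, cover ℝ^d. Let 𝒳 ⊂ ℝ^d be finite with x ∈ 𝒳, and suppose that for each i ∈ {1,…,I} there exists y_i ∈ 𝒳 with y_i ≠ x and ⟨y_i − x, u_i⟩ > |y_i − x|·cos(π/6). Then the Lebesgue measure of the Voronoi cell Ṽ(x;𝒳) is at most ω_d · max_{1≤i≤I} |y_i − x|^d, where ω_d is the Lebesgue measure of the unit ball in ℝ^d. -/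
open MeasureTheory Filter Topology
open scoped RealInnerProductSpace

noncomputable section

/-- If closed cones of angular radius `π/12` with apex `x` and directions `u i` cover `ℝ^d`,
and for each `i` there is a point `y i ∈ 𝒳 \ {x}` in the open concentric cone of angular
radius `π/6`, then `|Ṽ(x;𝒳)| ≤ ω_d · max_i |y i − x|^d`. -/
theorem stmt6 {d : ℕ} (hd : 1 ≤ d) (x : EucSp d) (I : ℕ) (hI : 0 < I)
    (u : Fin I → EucSp d) (hu : ∀ i, ‖u i‖ = 1)
    (hcover : ∀ z : EucSp d, ∃ i, ‖z - x‖ * Real.cos (Real.pi / 12) ≤ ⟪z - x, u i⟫)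
    (𝒳 : Set (EucSp d)) (h𝒳 : 𝒳.Finite) (hx : x ∈ 𝒳)
    (y : Fin I → EucSp d) (hy𝒳 : ∀ i, y i ∈ 𝒳) (hyx : ∀ i, y i ≠ x)
    (hyC : ∀ i, ‖y i - x‖ * Real.cos (Real.pi / 6) < ⟪y i - x, u i⟫) :
    volume (vorCell x 𝒳) ≤
      volume (Metric.closedBall (0 : EucSp d) 1) *
        ENNReal.ofReal (⨆ i, ‖y i - x‖ ^ d) := by
  haveI : Nonempty (Fin I) := ⟨⟨0, hI⟩⟩
  obtain ⟨j, hj⟩ := Finite.exists_max (fun i => ‖y i - x‖)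
  have hsub : vorCell x 𝒳 ⊆ Metric.closedBall x ‖y j - x‖ := by
    intro z hz
    obtain ⟨i, hi⟩ := hcover z
    have h1 := hz (y i) (hy𝒳 i)
    rw [Metric.mem_closedBall, dist_eq_norm]
    refine le_trans ?_ (hj i)
    show ‖z - x‖ ≤ ‖y i - x‖
    rw [dist_eq_norm, dist_eq_norm] at h1
    have hyi := hyC i
    have hui := hu i
    have e : z - y i = (z - x) - (y i - x) := by abel
    have hv : 0 < ‖y i - x‖ := norm_pos_iff.2 (sub_ne_zero.2 (hyx i))
    rw [e] at h1
    generalize z - x = w at *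
    generalize y i - x = v at *
    by_cases hw0 : w = 0
    · simp [hw0]
    have hw : 0 < ‖w‖ := norm_pos_iff.2 hw0
    have h2 := norm_sub_sq_real w v
    have h3 : ‖w‖ ^ 2 ≤ ‖w - v‖ ^ 2 := by gcongr
    have pp := Real.pi_pos
    have a1 : InnerProductGeometry.angle w (u i) ≤ Real.pi / 12 := by
      by_contra hc
      push Not at hc
      have := Real.cos_lt_cos_of_nonneg_of_le_pi (by positivity)
        (InnerProductGeometry.angle_le_pi w (u i)) hc
      have h4 := InnerProductGeometry.cos_angle_mul_norm_mul_norm w (u i)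
      rw [hui, mul_one] at h4
      nlinarith
    have a2 : InnerProductGeometry.angle (u i) v ≤ Real.pi / 6 := by
      rw [InnerProductGeometry.angle_comm]
      by_contra hc
      push Not at hc
      have := Real.cos_lt_cos_of_nonneg_of_le_pi (by positivity)
        (InnerProductGeometry.angle_le_pi v (u i)) hc
      have h4 := InnerProductGeometry.cos_angle_mul_norm_mul_norm v (u i)
      rw [hui, mul_one] at h4
      nlinarith
    have a3 := InnerProductGeometry.angle_le_angle_add_angle w (u i) v
    have a4 : Real.cos (Real.pi / 3) ≤ Real.cos (InnerProductGeometry.angle w v) :=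
      Real.cos_le_cos_of_nonneg_of_le_pi (InnerProductGeometry.angle_nonneg w v)
        (by linarith) (by linarith)
    rw [Real.cos_pi_div_three] at a4
    have h5 := InnerProductGeometry.cos_angle_mul_norm_mul_norm w v
    have h6 : 1 / 2 * (‖w‖ * ‖v‖) ≤ ⟪w, v⟫ := by
      rw [← h5]; gcongr
    have h7 : ‖w‖ * ‖v‖ ≤ ‖v‖ * ‖v‖ := by nlinarith
    exact le_of_mul_le_mul_right h7 hv
  refine (measure_mono hsub).trans ?_
  rw [Measure.addHaar_closedBall' volume x (norm_nonneg _), mul_comm]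
  gcongr
  rw [finrank_euclideanSpace_fin]
  exact le_ciSup (f := fun i => ‖y i - x‖ ^ d) (Set.finite_range _).bddAbove j
end
end

section
/- Let β ≥ 1, let p' > 2(β + 1) and let C < ∞. Suppose that for each n ∈ ℕ there is a filtration (ℱ_{n,i})_{0≤i≤n} on a probability space and random variables d_{n,1}, …, d_{n,n} such that d_{n,i} is ℱ_{n,i}-measurable, E[d_{n,i} | ℱ_{n,i−1}] = 0 almost surely, ‖d_{n,i}‖_∞ ≤ C·n^β and E[|d_{n,i}|^{p'}] ≤ C for all 1 ≤ i ≤ n. Then for every ε > 0, Σ_{n=1}^∞ P[ |Σ_{i=1}^n d_{n,i}| > ε·n ] < ∞; in particular, n^{−1}·Σ_{i=1}^n d_{n,i} → 0 completely and hence almost surely. (This is the complete-convergence argument for martingale difference arrays used in the proof of Theorem 2.2.) -/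
open MeasureTheory ProbabilityTheory Filter Topology

noncomputable section

lemma aux_int {Ω : Type*} [MeasurableSpace Ω] {μ : Measure Ω} [IsProbabilityMeasure μ]
    {f : Ω → ℝ} (hf : Measurable f) (B : ℝ) (hB : ∀ᵐ ω ∂μ, |f ω| ≤ B) : Integrable f μ :=
  Integrable.of_bound hf.aestronglyMeasurable B (by simpa using hB)

lemma aux_step {Ω : Type*} (m : MeasurableSpace Ω) {m0 : MeasurableSpace Ω} {μ : Measure Ω}
    [IsProbabilityMeasure μ] (hm : m ≤ m0) (S d : Ω → ℝ) (hS : Measurable[m] S)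
    (hd : Measurable d) (hc : μ[d|m] =ᵐ[μ] 0) (A B : ℝ)
    (hA : ∀ᵐ ω ∂μ, |S ω| ≤ A) (hB : ∀ᵐ ω ∂μ, |d ω| ≤ B) (M : ℝ)
    (hM : ∫ ω, d ω ^ 4 ∂μ ≤ M) (k : ℕ)
    (ih : ∫ ω, S ω ^ 4 ∂μ ≤ 19 * M * k ^ 2) :
    ∫ ω, (S ω + d ω) ^ 4 ∂μ ≤ 19 * M * (k + 1 : ℝ) ^ 2 := by
  have hS0 : Measurable S := hS.mono hm le_rfl
  have hbd : ∀ a b : ℕ, Integrable (fun ω => S ω ^ a * d ω ^ b) μ := by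
    intro a b
    refine aux_int (by fun_prop) (A ^ a * B ^ b) ?_
    filter_upwards [hA, hB] with ω h1 h2
    rw [abs_mul, abs_pow, abs_pow]
    have := abs_nonneg (S ω)
    have := abs_nonneg (d ω)
    have : 0 ≤ A := by linarith
    gcongr
  have hS4 : Integrable (fun ω => S ω ^ 4) μ := by simpa using hbd 4 0
  have hd4 : Integrable (fun ω => d ω ^ 4) μ := by simpa using hbd 0 4
  have hd1 : Integrable d μ := by simpa using hbd 0 1
  have hS3d : Integrable (fun ω => S ω ^ 3 * d ω) μ := by simpa using hbd 3 1
  have hz : ∫ ω, S ω ^ 3 * d ω ∂μ = 0 := by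
    have h1 : μ[(fun ω => S ω ^ 3) * d|m] =ᵐ[μ] (fun ω => S ω ^ 3) * μ[d|m] :=
      condExp_mul_of_stronglyMeasurable_left (hS.pow_const 3).stronglyMeasurable hS3d hd1
    have h2 : ∫ ω, (μ[(fun ω => S ω ^ 3) * d|m]) ω ∂μ = ∫ ω, S ω ^ 3 * d ω ∂μ :=
      integral_condExp hm
    rw [← h2]
    apply integral_eq_zero_of_ae
    filter_upwards [h1, hc] with ω h3 h4
    rw [h3]; simp [h4]
  have hk : (0 : ℝ) < (k : ℝ) + 1 := by positivity
  have hpt : ∀ ω, (S ω + d ω) ^ 4 ≤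
      (1 + 1 / ((k : ℝ) + 1)) * S ω ^ 4 + 4 * (S ω ^ 3 * d ω)
        + (16 * ((k : ℝ) + 1) + 3) * d ω ^ 4 := by
    intro ω
    generalize S ω = s
    generalize d ω = x
    have e1 : 0 ≤ (1 / ((k : ℝ) + 1)) * (s ^ 2 - 4 * ((k : ℝ) + 1) * x ^ 2) ^ 2 := by positivity
    have e2 : (1 / ((k : ℝ) + 1)) * (s ^ 2 - 4 * ((k : ℝ) + 1) * x ^ 2) ^ 2
        = 1 / ((k : ℝ) + 1) * s ^ 4 - 8 * s ^ 2 * x ^ 2 + 16 * ((k : ℝ) + 1) * x ^ 4 := by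
      field_simp
      ring
    have e3 : 0 ≤ 2 * (s * x - x ^ 2) ^ 2 := by positivity
    nlinarith
  have hM0 : 0 ≤ M := le_trans (integral_nonneg fun ω => by positivity) hM
  have i1 := hS4.const_mul (1 + 1 / ((k : ℝ) + 1))
  have i2 := hS3d.const_mul 4
  have i3 := hd4.const_mul (16 * ((k : ℝ) + 1) + 3)
  have hI : Integrable (fun ω => (1 + 1 / ((k : ℝ) + 1)) * S ω ^ 4 + 4 * (S ω ^ 3 * d ω)
        + (16 * ((k : ℝ) + 1) + 3) * d ω ^ 4) μ := (i1.add i2).add i3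
  have hle := integral_mono_of_nonneg (μ := μ)
    (Eventually.of_forall fun ω => show (0 : ℝ) ≤ (S ω + d ω) ^ 4 by positivity) hI
    (Eventually.of_forall hpt)
  have heq : ∫ ω, ((1 + 1 / ((k : ℝ) + 1)) * S ω ^ 4 + 4 * (S ω ^ 3 * d ω)
        + (16 * ((k : ℝ) + 1) + 3) * d ω ^ 4) ∂μ
      = (1 + 1 / ((k : ℝ) + 1)) * ∫ ω, S ω ^ 4 ∂μ
        + (16 * ((k : ℝ) + 1) + 3) * ∫ ω, d ω ^ 4 ∂μ := by
    have i12 : Integrable (fun ω => (1 + 1 / ((k : ℝ) + 1)) * S ω ^ 4 + 4 * (S ω ^ 3 * d ω)) μ :=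
      i1.add i2
    rw [integral_add i12 i3, integral_add i1 i2, integral_const_mul, integral_const_mul,
      integral_const_mul, hz]
    ring
  refine hle.trans ?_
  rw [heq]
  have b1 : (1 + 1 / ((k : ℝ) + 1)) * ∫ ω, S ω ^ 4 ∂μ
      ≤ (1 + 1 / ((k : ℝ) + 1)) * (19 * M * k ^ 2) := by gcongr
  have b2 : (16 * ((k : ℝ) + 1) + 3) * ∫ ω, d ω ^ 4 ∂μ
      ≤ (16 * ((k : ℝ) + 1) + 3) * M := by gcongr
  have b3 : 1 / ((k : ℝ) + 1) * (k : ℝ) ^ 2 ≤ k := by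
    rw [one_div_mul_eq_div, div_le_iff₀ hk]
    have : (0 : ℝ) ≤ k := by positivity
    nlinarith
  have b4 : M * (1 / ((k : ℝ) + 1) * (k : ℝ) ^ 2) ≤ M * k := by gcongr
  have b5 : 0 ≤ M * (k : ℝ) := by positivity
  nlinarith

lemma aux_n {Ω : Type*} {m0 : MeasurableSpace Ω} {μ : Measure Ω} [IsProbabilityMeasure μ]
    (n : ℕ) (F : ℕ → MeasurableSpace Ω) (hmono : Monotone F) (hle : ∀ i, F i ≤ m0)
    (D : ℕ → Ω → ℝ) (had : ∀ i, 1 ≤ i → i ≤ n → Measurable[F i] (D i))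
    (hc : ∀ i, 1 ≤ i → i ≤ n → μ[D i|F (i - 1)] =ᵐ[μ] 0) (B M : ℝ)
    (hB : ∀ i, 1 ≤ i → i ≤ n → ∀ᵐ ω ∂μ, |D i ω| ≤ B)
    (hM : ∀ i, 1 ≤ i → i ≤ n → ∫ ω, D i ω ^ 4 ∂μ ≤ M) (k : ℕ) (hk : k ≤ n) :
    Measurable[F k] (fun ω => ∑ i ∈ Finset.Icc 1 k, D i ω) ∧
    (∀ᵐ ω ∂μ, |∑ i ∈ Finset.Icc 1 k, D i ω| ≤ k * B) ∧
    ∫ ω, (∑ i ∈ Finset.Icc 1 k, D i ω) ^ 4 ∂μ ≤ 19 * M * k ^ 2 := by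
  induction k with
  | zero => simp
  | succ k ih =>
    obtain ⟨h1, h2, h3⟩ := ih (by omega)
    have e : ∀ ω, ∑ i ∈ Finset.Icc 1 (k + 1), D i ω
        = ∑ i ∈ Finset.Icc 1 k, D i ω + D (k + 1) ω := fun ω =>
      Finset.sum_Icc_succ_top (by omega) _
    simp only [e]
    have hd := had (k + 1) (by omega) hk
    have hb := hB (k + 1) (by omega) hk
    refine ⟨?_, ?_, ?_⟩
    · exact (h1.mono (hmono (Nat.le_succ k)) le_rfl).add hd
    · filter_upwards [h2, hb] with ω g1 g2
      push_cast
      linarith [abs_add_le (∑ i ∈ Finset.Icc 1 k, D i ω) (D (k + 1) ω)]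
    · push_cast
      exact aux_step (F k) (hle k) _ _ h1 (hd.mono (hle _) le_rfl)
        (hc (k + 1) (by omega) hk) _ _ h2 hb M (hM _ (by omega) hk) k h3

/-- The complete-convergence argument for martingale difference arrays used in the proof
of Theorem 2.2: if `β ≥ 1`, `p' > 2(β+1)`, and for each `n` the variables
`D n 1, …, D n n` form a martingale difference sequence with `‖D n i‖_∞ ≤ C n^β` and
`E|D n i|^{p'} ≤ C`, then for every `ε > 0` the probabilities
`P[|Σ_{i=1}^n D n i| > εn]` are summable in `n`; in particular
`n⁻¹ Σ_{i=1}^n D n i → 0` completely and hence almost surely. -/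
theorem stmt15 {Ωp : Type*} [MeasureSpace Ωp] [IsProbabilityMeasure (ℙ : Measure Ωp)]
    (β : ℝ) (hβ : 1 ≤ β) (p' : ℝ) (hp' : 2 * (β + 1) < p') (C : ℝ)
    (ℱ : ℕ → ℕ → MeasurableSpace Ωp)
    (hmono : ∀ n, Monotone (ℱ n))
    (hle : ∀ n i, ℱ n i ≤ (inferInstance : MeasurableSpace Ωp))
    (D : ℕ → ℕ → Ωp → ℝ)
    (hadapted : ∀ n i, 1 ≤ i → i ≤ n → Measurable[ℱ n i] (D n i))
    (hmart : ∀ n i, 1 ≤ i → i ≤ n → ℙ[D n i|ℱ n (i - 1)] =ᵐ[ℙ] 0)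
    (hbdd : ∀ n i, 1 ≤ i → i ≤ n →
      eLpNorm (D n i) ⊤ ℙ ≤ ENNReal.ofReal (C * (n : ℝ) ^ β))
    (hmom : ∀ n i, 1 ≤ i → i ≤ n → ∫ ω, |D n i ω| ^ p' ∂ℙ ≤ C) :
    (∀ ε > 0, Summable fun n : ℕ =>
        (ℙ {ω | ε * n < |∑ i ∈ Finset.Icc 1 n, D n i ω|}).toReal) ∧
      ∀ᵐ ω ∂ℙ, Tendsto (fun n : ℕ => (n : ℝ)⁻¹ * ∑ i ∈ Finset.Icc 1 n, D n i ω)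
        atTop (𝓝 0) := by
  have hmeas : ∀ n i, 1 ≤ i → i ≤ n → Measurable (D n i) := fun n i h1 h2 =>
    (hadapted n i h1 h2).mono (hle n i) le_rfl
  have hB : ∀ n i, 1 ≤ i → i ≤ n →
      ∀ᵐ ω ∂(ℙ : Measure Ωp), |D n i ω| ≤ (ENNReal.ofReal (C * (n : ℝ) ^ β)).toReal := by
    intro n i h1 h2
    have h := hbdd n i h1 h2
    rw [eLpNorm_exponent_top] at h
    filter_upwards [ae_le_eLpNormEssSup (f := D n i) (μ := (ℙ : Measure Ωp))] with ω hω
    have := ENNReal.toReal_mono ENNReal.ofReal_ne_top (hω.trans h)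
    simpa using this
  have hM : ∀ n i, 1 ≤ i → i ≤ n → ∫ ω, D n i ω ^ 4 ∂(ℙ : Measure Ωp) ≤ 1 + |C| := by
    intro n i h1 h2
    have hp0 : (4 : ℝ) ≤ p' := by linarith
    have hint : Integrable (fun ω => |D n i ω| ^ p') (ℙ : Measure Ωp) := by
      have := hmeas n i h1 h2
      refine aux_int (by fun_prop) ((ENNReal.ofReal (C * (n : ℝ) ^ β)).toReal ^ p') ?_
      filter_upwards [hB n i h1 h2] with ω hω
      rw [abs_of_nonneg (by positivity)]
      exact Real.rpow_le_rpow (abs_nonneg _) hω (by linarith)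
    have hI : Integrable (fun ω => 1 + |D n i ω| ^ p') (ℙ : Measure Ωp) :=
      (integrable_const 1).add hint
    have hpt : ∀ ω, D n i ω ^ 4 ≤ 1 + |D n i ω| ^ p' := by
      intro ω
      have e : D n i ω ^ 4 = |D n i ω| ^ 4 := by
        rw [← abs_pow, abs_of_nonneg (by positivity)]
      rw [e]
      have hn := abs_nonneg (D n i ω)
      generalize |D n i ω| = x at *
      have hx : 0 ≤ x ^ p' := by positivity
      rcases le_total x 1 with h | h
      · have := pow_le_one₀ (n := 4) hn h
        linarith
      · have := Real.rpow_le_rpow_of_exponent_le h hp0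
        have e2 : x ^ (4 : ℝ) = x ^ (4 : ℕ) := by
          rw [← Real.rpow_natCast]; norm_num
        rw [e2] at this
        linarith
    have hle := integral_mono_of_nonneg (μ := (ℙ : Measure Ωp))
      (Eventually.of_forall fun ω => show (0 : ℝ) ≤ D n i ω ^ 4 by positivity) hI
      (Eventually.of_forall hpt)
    rw [integral_add (integrable_const 1) hint] at hle
    have := hmom n i h1 h2
    simp at hle
    linarith [le_abs_self C]
  have hsum : ∀ ε > 0, Summable fun n : ℕ =>
        ((ℙ : Measure Ωp) {ω | ε * n < |∑ i ∈ Finset.Icc 1 n, D n i ω|}).toReal := by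
    intro ε hε
    have hs : Summable fun n : ℕ => (19 * (1 + |C|) / ε ^ 4) * (1 / (n : ℝ) ^ 2) :=
      (Real.summable_one_div_nat_pow.mpr (by norm_num)).mul_left _
    refine Summable.of_nonneg_of_le (fun n => ENNReal.toReal_nonneg) (fun n => ?_) hs
    rcases Nat.eq_zero_or_pos n with rfl | hn
    · simp
    obtain ⟨h1, h2, h3⟩ := aux_n n (ℱ n) (hmono n) (hle n) (D n) (hadapted n) (hmart n) _ _
      (hB n) (hM n) n le_rfl
    have hm : Measurable (fun ω => ∑ i ∈ Finset.Icc 1 n, D n i ω) := h1.mono (hle n n) le_rfl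
    have hint : Integrable (fun ω => (∑ i ∈ Finset.Icc 1 n, D n i ω) ^ 4)
        (ℙ : Measure Ωp) := by
      refine aux_int (hm.pow_const 4)
        ((n * (ENNReal.ofReal (C * (n : ℝ) ^ β)).toReal) ^ 4) ?_
      filter_upwards [h2] with ω hω
      rw [abs_pow]
      gcongr
    have hn' : (0 : ℝ) < n := by exact_mod_cast hn
    have hmk := mul_meas_ge_le_integral_of_nonneg (μ := (ℙ : Measure Ωp))
      (Eventually.of_forall fun ω => show
        (0 : ℝ) ≤ (∑ i ∈ Finset.Icc 1 n, D n i ω) ^ 4 by positivity) hint ((ε * n) ^ 4)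
    have hsub : ((ℙ : Measure Ωp) {ω | ε * n < |∑ i ∈ Finset.Icc 1 n, D n i ω|}).toReal
        ≤ (ℙ : Measure Ωp).real {ω | (ε * n) ^ 4 ≤ (∑ i ∈ Finset.Icc 1 n, D n i ω) ^ 4} := by
      refine measureReal_mono ?_
      intro ω hω
      change ε * n < |∑ i ∈ Finset.Icc 1 n, D n i ω| at hω
      change (ε * n) ^ 4 ≤ (∑ i ∈ Finset.Icc 1 n, D n i ω) ^ 4
      have e : (∑ i ∈ Finset.Icc 1 n, D n i ω) ^ 4
          = |∑ i ∈ Finset.Icc 1 n, D n i ω| ^ 4 := by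
        rw [← abs_pow, abs_of_nonneg (by positivity)]
      rw [e]
      gcongr
    refine hsub.trans ?_
    have h4 := hmk.trans h3
    rw [mul_comm, ← le_div_iff₀ (by positivity)] at h4
    refine h4.trans (le_of_eq ?_)
    field_simp
  refine ⟨hsum, ?_⟩
  have hbc : ∀ m : ℕ, ∀ᵐ ω ∂(ℙ : Measure Ωp), ∀ᶠ n : ℕ in atTop,
      ω ∉ {ω | (1 / ((m : ℝ) + 1)) * n < |∑ i ∈ Finset.Icc 1 n, D n i ω|} := by
    intro m
    refine ae_eventually_notMem ?_
    have := (hsum (1 / ((m : ℝ) + 1)) (by positivity)).tsum_ofReal_ne_top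
    simpa [ENNReal.ofReal_toReal, measure_ne_top] using this
  filter_upwards [ae_all_iff.mpr hbc] with ω hω
  rw [Metric.tendsto_atTop']
  intro ε hε
  obtain ⟨m, hm⟩ := exists_nat_one_div_lt hε
  obtain ⟨N, hN⟩ := eventually_atTop.mp (hω m)
  refine ⟨N, fun n hn => ?_⟩
  have h := hN n hn.le
  replace h := not_lt.mp h
  have hn' : (0 : ℝ) < n := by exact_mod_cast (by omega : 0 < n)
  rw [dist_zero_right, Real.norm_eq_abs, abs_mul, abs_of_pos (inv_pos.mpr hn'),
    inv_mul_lt_iff₀ hn']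
  nlinarith
end
end
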